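/- Let S be a second countable locally compact Hausdorff groupoid with Haar system {κ^u} and let μ be a quasi-invariant Radon measure on S⁽⁰⁾. Then the modular function Δ of μ (the Radon–Nikodym derivative of ν = ∫κ^u dμ(u) with respect to its image under inversion) may be chosen to be a Borel homomorphism: Δ(γη) = Δ(γ)Δ(η) for all composable γ,η off a ν-null set closed under the groupoid operations, and in fact Δ can be chosen multiplicative everywhere on a restriction S|_V for a μ-conull set V. -/

import Mathlib

open MeasureTheory Filter Topology

/-- Algebraic data of a groupoid: arrows, objects (units), range, source,
unit inclusion, (total extensions of) composition and inversion. -/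
structure GroupoidData (Arr : Type) (Obj : Type) where
  r : Arr → Obj
  s : Arr → Obj
  unit : Obj → Arr
  comp : Arr → Arr → Arr
  inv : Arr → Arr

/-- The axioms making `GroupoidData` an honest groupoid (composition is only
required to behave on composable pairs). -/
structure GroupoidData.IsGroupoid {Arr Obj : Type} (D : GroupoidData Arr Obj) : Prop where
  r_unit : ∀ u, D.r (D.unit u) = u
  s_unit : ∀ u, D.s (D.unit u) = u
  r_comp : ∀ a b, D.s a = D.r b → D.r (D.comp a b) = D.r a
  s_comp : ∀ a b, D.s a = D.r b → D.s (D.comp a b) = D.s b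
  comp_assoc : ∀ a b c, D.s a = D.r b → D.s b = D.r c →
    D.comp (D.comp a b) c = D.comp a (D.comp b c)
  unit_comp : ∀ a, D.comp (D.unit (D.r a)) a = a
  comp_unit : ∀ a, D.comp a (D.unit (D.s a)) = a
  r_inv : ∀ a, D.r (D.inv a) = D.s a
  s_inv : ∀ a, D.s (D.inv a) = D.r a
  inv_comp : ∀ a, D.comp (D.inv a) a = D.unit (D.s a)
  comp_inv : ∀ a, D.comp a (D.inv a) = D.unit (D.r a)

/-- A left action of the groupoid `G` on a set `X` with moment map `rX`;
`lact γ x` is only meaningful when `G.s γ = rX x`. -/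
structure IsLeftActionOf {ArrG ObjG X : Type} (G : GroupoidData ArrG ObjG)
    (rX : X → ObjG) (lact : ArrG → X → X) : Prop where
  moment : ∀ γ x, G.s γ = rX x → rX (lact γ x) = G.r γ
  unit_act : ∀ x, lact (G.unit (rX x)) x = x
  comp_act : ∀ γ ξ x, G.s γ = G.r ξ → G.s ξ = rX x →
    lact (G.comp γ ξ) x = lact γ (lact ξ x)

/-- A right action of the groupoid `H` on a set `X` with moment map `sX`;
`ract x η` is only meaningful when `sX x = H.r η`. -/
structure IsRightActionOf {ArrH ObjH X : Type} (H : GroupoidData ArrH ObjH)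
    (sX : X → ObjH) (ract : X → ArrH → X) : Prop where
  moment : ∀ x η, sX x = H.r η → sX (ract x η) = H.s η
  unit_act : ∀ x, ract x (H.unit (sX x)) = x
  comp_act : ∀ x η ζ, sX x = H.r η → H.s η = H.r ζ →
    ract x (H.comp η ζ) = ract (ract x η) ζ

/-- The algebraic part of `X` being a `(G,H)`-equivalence: commuting free
left `G`- and right `H`-actions, each moment map invariant under the other
action, whose fibres are exactly the orbits of the other action, and both
moment maps surjective. -/
structure IsEquivalenceData {ArrG ObjG ArrH ObjH X : Type}
    (G : GroupoidData ArrG ObjG) (H : GroupoidData ArrH ObjH)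
    (rX : X → ObjG) (sX : X → ObjH)
    (lact : ArrG → X → X) (ract : X → ArrH → X) : Prop where
  left_action : IsLeftActionOf G rX lact
  right_action : IsRightActionOf H sX ract
  commute : ∀ γ x η, G.s γ = rX x → sX x = H.r η →
    ract (lact γ x) η = lact γ (ract x η)
  rX_ract : ∀ x η, sX x = H.r η → rX (ract x η) = rX x
  sX_lact : ∀ γ x, G.s γ = rX x → sX (lact γ x) = sX x
  free_left : ∀ γ x, G.s γ = rX x → lact γ x = x → γ = G.unit (rX x)
  free_right : ∀ x η, sX x = H.r η → ract x η = x → η = H.unit (sX x)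
  rX_fibres : ∀ x y, rX x = rX y ↔ ∃ η, sX x = H.r η ∧ ract x η = y
  sX_fibres : ∀ x y, sX x = sX y ↔ ∃ γ, G.s γ = rX x ∧ lact γ x = y
  rX_surj : Function.Surjective rX
  sX_surj : Function.Surjective sX

/-- Continuity of the structure maps of a topological groupoid. -/
structure IsTopologicalGroupoid {Arr Obj : Type} [TopologicalSpace Arr]
    [TopologicalSpace Obj] (D : GroupoidData Arr Obj) : Prop where
  continuous_r : Continuous D.r
  continuous_s : Continuous D.s
  continuous_unit : Continuous D.unit
  continuous_inv : Continuous D.inv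
  continuous_comp : Continuous fun p : {q : Arr × Arr // D.s q.1 = D.r q.2} =>
    D.comp p.val.1 p.val.2

/-- A Haar system for groupoid data `D`, relative to a set `Real` of
"genuine" arrows (take `Real = Set.univ` for an honest groupoid): a family
of Radon measures `κ u`, `u` a unit, with support exactly the genuine arrows
with range `u`, left invariant, and continuous against compactly supported
continuous functions. -/
def IsHaarSystemOn {Arr Obj : Type} [TopologicalSpace Arr] [TopologicalSpace Obj]
    [MeasurableSpace Arr] (D : GroupoidData Arr Obj) (Real : Set Arr)
    (κ : Obj → MeasureTheory.Measure Arr) : Prop :=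
  (∀ u, κ u ({a | D.r a = u} ∩ Real)ᶜ = 0) ∧
  (∀ u U, IsOpen U → (U ∩ ({a | D.r a = u} ∩ Real)).Nonempty → 0 < κ u U) ∧
  (∀ u K, IsCompact K → κ u K < ⊤) ∧
  (∀ a ∈ Real, ∀ f : Arr → ℝ, Continuous f → HasCompactSupport f →
    ∫ b, f (D.comp a b) ∂(κ (D.s a)) = ∫ b, f b ∂(κ (D.r a))) ∧
  (∀ f : Arr → ℝ, Continuous f → HasCompactSupport f →
    Continuous fun u => ∫ b, f b ∂(κ u))

/-- The measure `ν = μ ∘ κ` on the arrows induced by a measure `μ` on the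
units and a Haar system `κ`. -/
noncomputable def nuMeasure {Arr Obj : Type} [MeasurableSpace Arr] [MeasurableSpace Obj]
    (κ : Obj → MeasureTheory.Measure Arr) (μ : MeasureTheory.Measure Obj) :
    MeasureTheory.Measure Arr :=
  μ.bind κ

/-- Quasi-invariance of a measure `μ` on the unit space: `ν = μ∘κ` is
equivalent to its image under the inversion map. -/
def IsQuasiInvariant {Arr Obj : Type} [MeasurableSpace Arr] [MeasurableSpace Obj]
    (κ : Obj → MeasureTheory.Measure Arr) (inv : Arr → Arr)
    (μ : MeasureTheory.Measure Obj) : Prop :=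
  nuMeasure κ μ ≪ (nuMeasure κ μ).map inv ∧ (nuMeasure κ μ).map inv ≪ nuMeasure κ μ

open scoped ENNReal

open ProbabilityTheory

section HaarTopology

variable {X Y : Type*} [TopologicalSpace X] [T2Space X] [SecondCountableTopology X]
  [LocallyCompactSpace X] [MeasurableSpace X] [BorelSpace X]

/-- An open subset of a second countable locally compact Hausdorff space is exhausted, uniformly
in the measure, by countably many compactly supported continuous functions. -/
lemma IsOpen.exists_measure_eq_iSup_integral {U : Set X} (hU : IsOpen U) :
    ∃ f : ℕ → X → ℝ, (∀ n, Continuous (f n) ∧ HasCompactSupport (f n)) ∧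
      ∀ m : Measure X, (∀ K, IsCompact K → m K < ⊤) →
        m U = ⨆ n, ENNReal.ofReal (∫ x, f n x ∂m) := by
  have := hU.locallyCompactSpace
  let L : ℕ → Set X := fun n => Subtype.val '' compactCovering U n
  have hLc (n) : IsCompact (L n) := (isCompact_compactCovering U n).image continuous_subtype_val
  have hLU (n) : L n ⊆ U := by rintro _ ⟨x, -, rfl⟩; exact x.2
  have hLun : ⋃ n, L n = U := by
    rw [← Set.image_iUnion, iUnion_compactCovering, Set.image_univ, Subtype.range_coe]
  have hLm : Monotone L := fun _ _ h => Set.image_mono (compactCovering_subset U h)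
  choose f hf1 hfc hfs hf01 using fun n =>
    exists_continuousMap_one_of_isCompact_subset_isOpen (hLc n) hU (hLU n)
  refine ⟨fun n => f n, fun n => ⟨(f n).continuous, hfc n⟩, fun m hm => ?_⟩
  have : IsFiniteMeasureOnCompacts m := ⟨fun K hK => hm K hK⟩
  have hlint (n) : ENNReal.ofReal (∫ x, f n x ∂m) = ∫⁻ x, ENNReal.ofReal (f n x) ∂m :=
    ofReal_integral_eq_lintegral_ofReal
      ((f n).continuous.integrable_of_hasCompactSupport (hfc n))
      (ae_of_all _ fun x => (hf01 n x).1)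
  apply le_antisymm
  · rw [← hLun, hLm.measure_iUnion]
    refine iSup_mono fun n => ?_
    rw [hlint, ← lintegral_indicator_one (hLc n).measurableSet]
    refine lintegral_mono fun x => Set.indicator_apply_le' (fun hx => ?_) fun _ => zero_le
    simp [hf1 n hx]
  · refine iSup_le fun n => ?_
    rw [hlint, ← lintegral_indicator_one hU.measurableSet]
    refine lintegral_mono fun x => ?_
    by_cases hx : x ∈ U
    · simpa [hx] using (hf01 n x).2
    · simp [image_eq_zero_of_notMem_tsupport fun h => hx (hfs n h)]

/-- A family of Radon measures depending continuously on a parameter in the vague topology is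
Borel. -/
lemma measurable_of_continuous_integral [TopologicalSpace Y] [MeasurableSpace Y] [BorelSpace Y]
    {κ : Y → Measure X} (hfin : ∀ u K, IsCompact K → κ u K < ⊤)
    (hcont : ∀ f : X → ℝ, Continuous f → HasCompactSupport f →
      Continuous fun u => ∫ b, f b ∂(κ u)) : Measurable κ := by
  have hopen {U : Set X} (hU : IsOpen U) : Measurable fun u => κ u U := by
    obtain ⟨f, hf, h⟩ := hU.exists_measure_eq_iSup_integral
    simp only [fun u => h (κ u) (hfin u)]
    exact .iSup fun n => (hcont _ (hf n).1 (hf n).2).measurable.ennreal_ofReal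
  let E : CompactExhaustion X := default
  have hE (n) : Measurable fun u => (κ u).restrict (interior (E n)) := by
    have hfinE (u) : IsFiniteMeasure ((κ u).restrict (interior (E n))) :=
      ⟨by simpa using (measure_mono interior_subset).trans_lt (hfin u _ (E.isCompact n))⟩
    refine Measurable.measure_of_isPiSystem BorelSpace.measurable_eq isPiSystem_isOpen
      (fun s hs => ?_) ?_
    · simp only [Measure.restrict_apply (IsOpen.measurableSet hs)]
      exact hopen (IsOpen.inter hs isOpen_interior)
    · simpa using hopen isOpen_interior
  have hmono : Monotone fun n => interior (E n) := fun _ _ h => interior_mono (E.subset h)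
  have hcov : ⋃ n, interior (E n) = Set.univ :=
    Set.eq_univ_of_univ_subset <| by
      rw [← E.iUnion_eq]
      exact Set.iUnion_subset fun n =>
        (E.subset_interior_succ n).trans (Set.subset_iUnion (fun n => interior (E n)) (n + 1))
  refine Measure.measurable_of_measurable_coe _ fun s hs => ?_
  have hsup (u) : κ u s = ⨆ n, (κ u).restrict (interior (E n)) s := by
    simp only [Measure.restrict_apply hs]
    rw [← Monotone.measure_iUnion, ← Set.inter_iUnion, hcov, Set.inter_univ]
    exact fun _ _ h => Set.inter_subset_inter_right _ (hmono h)
  simp only [hsup]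
  exact .iSup fun n => (Measure.measurable_coe hs).comp (hE n)

/-- A Borel family of measures carried by the fibres of `r` and finite on each member of a
countable cover has a positive Borel weight making all of its members finite. -/
lemma exists_weight [MeasurableSpace Y] {κ : Y → Measure X} (hκ : Measurable κ) {r : X → Y}
    (hr : Measurable r) (hfib : ∀ u, ∀ᵐ a ∂κ u, r a = u)
    (hfin : ∀ u K, IsCompact K → κ u K < ⊤) :
    ∃ g : X → ℝ≥0∞, Measurable g ∧ (∀ a, g a ≠ 0) ∧ (∀ a, g a ≠ ⊤) ∧
      ∀ u, ∫⁻ a, g a ∂κ u ≤ 2 := by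
  let L := compactCovering X
  have hL (n) : MeasurableSet (L n) := (isCompact_compactCovering X n).measurableSet
  let w : ℕ → X → ℝ≥0∞ := fun n => (L n).indicator fun a => 2⁻¹ ^ n * (1 + κ (r a) (L n))⁻¹
  have hw (n) : Measurable (w n) :=
    ((((Measure.measurable_coe (hL n)).comp (hκ.comp hr)).const_add 1).inv.const_mul _).indicator
      (hL n)
  have htwo : ∑' n : ℕ, (2⁻¹ : ℝ≥0∞) ^ n = 2 := by simp
  refine ⟨fun a => ∑' n, w n a, .tsum hw, fun a => ?_, fun a => ?_, fun u => ?_⟩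
  · obtain ⟨n, hn⟩ := exists_mem_compactCovering a
    refine fun h => (ENNReal.tsum_eq_zero.1 h n).not_gt ?_
    simp only [w, Set.indicator_of_mem (show a ∈ L n from hn)]
    have := (hfin (r a) _ (isCompact_compactCovering X n)).ne
    refine ENNReal.mul_pos (by simp) (ENNReal.inv_ne_zero.2 (by finiteness))
  · refine ((ENNReal.tsum_le_tsum fun n => ?_).trans_lt (htwo.trans_lt (by simp))).ne
    refine Set.indicator_apply_le' (fun _ => ?_) fun _ => zero_le
    exact mul_le_of_le_one_right' (by simp)
  · rw [lintegral_tsum fun n => (hw n).aemeasurable, ← htwo]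
    refine ENNReal.tsum_le_tsum fun n => ?_
    rw [lintegral_indicator (hL n)]
    have : ∀ᵐ a ∂(κ u).restrict (L n),
        2⁻¹ ^ n * (1 + κ (r a) (L n))⁻¹ = 2⁻¹ ^ n * (1 + κ u (L n))⁻¹ := by
      filter_upwards [ae_restrict_of_ae (hfib u)] with a ha
      rw [ha]
    rw [lintegral_congr_ae this, setLIntegral_const, mul_assoc]
    refine mul_le_of_le_one_right' ?_
    rw [mul_comm, ← div_eq_mul_inv]
    exact ENNReal.div_le_of_le_mul (by simp)

end HaarTopology

namespace GroupoidData.IsGroupoid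

variable {Arr Obj : Type} {D : GroupoidData Arr Obj}

lemma inv_comp_cancel (hD : D.IsGroupoid) {a b : Arr} (h : D.s a = D.r b) :
    D.comp (D.inv a) (D.comp a b) = b := by
  rw [← hD.comp_assoc _ _ _ (hD.s_inv a) h, hD.inv_comp, h, hD.unit_comp]

lemma comp_inv_cancel (hD : D.IsGroupoid) {a b : Arr} (h : D.r a = D.r b) :
    D.comp a (D.comp (D.inv a) b) = b := by
  rw [← hD.comp_assoc _ _ _ (hD.r_inv a).symm ((hD.s_inv a).trans h), hD.comp_inv, h,
    hD.unit_comp]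

lemma comp_comp_inv_cancel (hD : D.IsGroupoid) {a b : Arr} (h : D.s a = D.r b) :
    D.comp (D.comp a b) (D.inv b) = a := by
  rw [hD.comp_assoc _ _ _ h (hD.r_inv b).symm, hD.comp_inv, ← h, hD.comp_unit]

lemma eq_inv_of_comp_eq_unit (hD : D.IsGroupoid) {a b : Arr} (h : D.s a = D.r b)
    (hab : D.comp a b = D.unit (D.r a)) : b = D.inv a := by
  rw [← hD.inv_comp_cancel h, hab, ← hD.s_inv a, hD.comp_unit]

lemma inv_inv (hD : D.IsGroupoid) (a : Arr) : D.inv (D.inv a) = a :=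
  (hD.eq_inv_of_comp_eq_unit (hD.s_inv a) (by rw [hD.inv_comp, hD.r_inv])).symm

lemma inv_comp_rev (hD : D.IsGroupoid) {a b : Arr} (h : D.s a = D.r b) :
    D.inv (D.comp a b) = D.comp (D.inv b) (D.inv a) := by
  have h' : D.s (D.inv b) = D.r (D.inv a) := by rw [hD.s_inv, hD.r_inv, h]
  refine (hD.eq_inv_of_comp_eq_unit ?_ ?_).symm
  · rw [hD.s_comp _ _ h, hD.r_comp _ _ h', hD.r_inv]
  · rw [hD.comp_assoc _ _ _ h (by rw [hD.r_comp _ _ h', hD.r_inv]),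
      hD.comp_inv_cancel (by rw [hD.r_inv, h]), hD.comp_inv, hD.r_comp _ _ h]

end GroupoidData.IsGroupoid

/-- The involution `(x, y) ↦ (x⁻¹, x⁻¹ y)` of the pairs of arrows with equal ranges. -/
def GroupoidData.shear {Arr Obj : Type} (D : GroupoidData Arr Obj) (p : Arr × Arr) : Arr × Arr :=
  (D.inv p.1, D.comp (D.inv p.1) p.2)

namespace GroupoidData.IsGroupoid

variable {Arr Obj : Type} {D : GroupoidData Arr Obj}

lemma r_shear (hD : D.IsGroupoid) {p : Arr × Arr} (hp : D.r p.1 = D.r p.2) :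
    D.r (D.shear p).1 = D.r (D.shear p).2 :=
  (hD.r_comp _ _ ((hD.s_inv _).trans hp)).symm

lemma shear_shear (hD : D.IsGroupoid) {p : Arr × Arr} (hp : D.r p.1 = D.r p.2) :
    D.shear (D.shear p) = p := by
  simp only [shear, hD.inv_inv, hD.comp_inv_cancel hp]

/-- The braid relation between the shear and the swap. -/
lemma shear_swap_shear (hD : D.IsGroupoid) {p : Arr × Arr} (hp : D.r p.1 = D.r p.2) :
    D.shear (D.shear p).swap = (D.shear p.swap).swap := by
  have h : D.s (D.inv p.1) = D.r p.2 := (hD.s_inv _).trans hp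
  have hinv : D.inv (D.comp (D.inv p.1) p.2) = D.comp (D.inv p.2) p.1 := by
    rw [hD.inv_comp_rev h, hD.inv_inv]
  have hs : D.s (D.inv p.2) = D.r p.1 := (hD.s_inv _).trans hp.symm
  simp only [shear, Prod.swap, hinv, hD.comp_comp_inv_cancel hs]

end GroupoidData.IsGroupoid

/-- A Borel left Haar system on a groupoid with Borel structure maps, together with a positive
Borel weight `g` for which all the measures become finite. -/
structure IsBorelHaarSystem {Arr Obj : Type} [MeasurableSpace Arr] [MeasurableSpace Obj]
    (D : GroupoidData Arr Obj) (K : Kernel Obj Arr) (g : Arr → ℝ≥0∞) : Prop where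
  measurable_r : Measurable D.r
  measurable_s : Measurable D.s
  measurable_inv : Measurable D.inv
  measurable_comp : Measurable (Function.uncurry D.comp)
  ae_r_eq : ∀ u, ∀ᵐ a ∂K u, D.r a = u
  ne_zero : ∀ u, K u ≠ 0
  map_comp : ∀ a, (K (D.s a)).map (D.comp a) = K (D.r a)
  measurable_weight : Measurable g
  weight_ne_zero : ∀ a, g a ≠ 0
  weight_ne_top : ∀ a, g a ≠ ⊤
  lintegral_weight_le : ∀ u, ∫⁻ a, g a ∂K u ≤ 2

lemma sigmaFinite_of_lintegral_ne_top {X : Type*} [MeasurableSpace X] {m : Measure X}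
    {w : X → ℝ≥0∞} (hw : Measurable w) (h0 : ∀ x, w x ≠ 0) (htop : ∀ x, w x ≠ ⊤)
    (hlint : ∫⁻ x, w x ∂m ≠ ⊤) : SigmaFinite m := by
  have : IsFiniteMeasure (m.withDensity w) := isFiniteMeasure_withDensity hlint
  rw [← withDensity_inv_same (μ := m) hw (ae_of_all _ h0) (ae_of_all _ htop)]
  exact SigmaFinite.withDensity_of_ne_top' fun x => ENNReal.inv_ne_top.2 (h0 x)

lemma exists_measurable_lintegral_le_one {X : Type*} [MeasurableSpace X] (μ : Measure X)
    [SigmaFinite μ] :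
    ∃ q : X → ℝ≥0∞, Measurable q ∧ (∀ u, q u ≠ 0) ∧ (∀ u, q u ≠ ⊤) ∧ ∫⁻ u, q u ∂μ ≤ 1 := by
  obtain ⟨q, hq0, hqm, hq⟩ := exists_pos_lintegral_lt_of_sigmaFinite μ one_ne_zero
  exact ⟨fun u => q u, hqm.coe_nnreal_ennreal, fun u => by simpa using (hq0 u).ne',
    fun u => ENNReal.coe_ne_top, hq.le⟩

namespace IsBorelHaarSystem

variable {Arr Obj : Type} [MeasurableSpace Arr] [MeasurableSpace Obj]
  {D : GroupoidData Arr Obj} {K : Kernel Obj Arr} {g : Arr → ℝ≥0∞}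

lemma measurable_comp_left (hK : IsBorelHaarSystem D K g) (a : Arr) : Measurable (D.comp a) :=
  hK.measurable_comp.comp measurable_prodMk_left

lemma measurable_shear (hK : IsBorelHaarSystem D K g) : Measurable D.shear := by
  have hi : Measurable fun p : Arr × Arr => D.inv p.1 := hK.measurable_inv.comp measurable_fst
  exact hi.prodMk (hK.measurable_comp.comp (hi.prodMk measurable_snd))

lemma isSFiniteKernel (hK : IsBorelHaarSystem D K g) : IsSFiniteKernel K := by
  have hg := hK.measurable_weight
  let P : Kernel Obj Arr :=
    { toFun := fun u => (K u).withDensity g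
      measurable' := Measure.measurable_of_measurable_coe _ fun s hs => by
        simp only [withDensity_apply _ hs, ← lintegral_indicator hs]
        exact (Measure.measurable_lintegral (hg.indicator hs)).comp K.measurable }
  have : IsFiniteKernel P := ⟨⟨2, by simp, fun u => by
    simpa [P, withDensity_apply] using hK.lintegral_weight_le u⟩⟩
  have hKP : K = P.withDensity fun _ a => (g a)⁻¹ := by
    ext1 u
    have hinv : Measurable (Function.uncurry fun (_ : Obj) a => (g a)⁻¹) :=
      hg.inv.comp measurable_snd
    rw [Kernel.withDensity_apply _ hinv]
    exact (withDensity_inv_same hg (ae_of_all _ hK.weight_ne_zero)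
      (ae_of_all _ hK.weight_ne_top)).symm
  rw [hKP]
  exact Kernel.IsSFiniteKernel.withDensity _ fun _ a => ENNReal.inv_ne_top.2 (hK.weight_ne_zero a)

lemma lintegral_comp (hK : IsBorelHaarSystem D K g) (a : Arr) {f : Arr → ℝ≥0∞}
    (hf : Measurable f) : ∫⁻ b, f (D.comp a b) ∂K (D.s a) = ∫⁻ b, f b ∂K (D.r a) := by
  rw [← hK.map_comp a, lintegral_map hf (hK.measurable_comp_left a)]

lemma ae_comp (hK : IsBorelHaarSystem D K g) (a : Arr) {p : Arr → Prop}
    (h : ∀ᵐ b ∂K (D.r a), p b) : ∀ᵐ b ∂K (D.s a), p (D.comp a b) := by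
  rw [← hK.map_comp a] at h
  exact ae_of_ae_map (hK.measurable_comp_left a).aemeasurable h

lemma sigmaFinite_bind (hK : IsBorelHaarSystem D K g) (μ : Measure Obj) [SigmaFinite μ] :
    SigmaFinite (μ.bind K) := by
  obtain ⟨q, hqm, hq0, hqt, hq⟩ := exists_measurable_lintegral_le_one μ
  have hm : Measurable fun a => q (D.r a) * g a :=
    (hqm.comp hK.measurable_r).mul hK.measurable_weight
  refine sigmaFinite_of_lintegral_ne_top hm
    (fun a => mul_ne_zero (hq0 _) (hK.weight_ne_zero a))
    (fun a => ENNReal.mul_ne_top (hqt _) (hK.weight_ne_top a)) ?_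
  rw [Measure.lintegral_bind K.aemeasurable hm.aemeasurable]
  refine ((lintegral_mono (g := fun u => q u * 2) fun u => ?_).trans_lt ?_).ne
  · calc ∫⁻ a, q (D.r a) * g a ∂K u = ∫⁻ a, q u * g a ∂K u :=
          lintegral_congr_ae ((hK.ae_r_eq u).mono fun a ha => by simp only [ha])
      _ = q u * ∫⁻ a, g a ∂K u := lintegral_const_mul _ hK.measurable_weight
      _ ≤ q u * 2 := by gcongr; exact hK.lintegral_weight_le u
  · rw [lintegral_mul_const _ hqm]
    exact ENNReal.mul_lt_top (hq.trans_lt (by simp)) (by simp)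

/-- The measure on the pairs of arrows with equal ranges induced by `μ` and the Haar system. -/
noncomputable def pairMeasure (hK : IsBorelHaarSystem D K g) (μ : Measure Obj) :
    Measure (Arr × Arr) :=
  (μ.bind K) ⊗ₘ (K.comap D.r hK.measurable_r)

variable {μ : Measure Obj} [SigmaFinite μ]

lemma lintegral_pairMeasure' (hK : IsBorelHaarSystem D K g) {G : Arr × Arr → ℝ≥0∞}
    (hG : Measurable G) :
    ∫⁻ p, G p ∂hK.pairMeasure μ = ∫⁻ x, ∫⁻ y, G (x, y) ∂K (D.r x) ∂(μ.bind K) := by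
  have := hK.isSFiniteKernel
  have := hK.sigmaFinite_bind μ
  rw [pairMeasure, Measure.lintegral_compProd hG]
  simp [Kernel.comap_apply]

lemma lintegral_pairMeasure (hK : IsBorelHaarSystem D K g) {G : Arr × Arr → ℝ≥0∞}
    (hG : Measurable G) :
    ∫⁻ p, G p ∂hK.pairMeasure μ = ∫⁻ u, ∫⁻ x, ∫⁻ y, G (x, y) ∂K u ∂K u ∂μ := by
  have := hK.isSFiniteKernel
  rw [hK.lintegral_pairMeasure' hG, Measure.lintegral_bind K.aemeasurable]
  · refine lintegral_congr fun u => lintegral_congr_ae ?_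
    filter_upwards [hK.ae_r_eq u] with x hx
    rw [hx]
  · exact (Measurable.lintegral_kernel_prod_right (κ := K.comap D.r hK.measurable_r)
      (f := fun x y => G (x, y)) hG).aemeasurable

lemma lintegral_pairMeasure_congr (hK : IsBorelHaarSystem D K g) {F G : Arr × Arr → ℝ≥0∞}
    (hF : Measurable F) (hG : Measurable G) (h : ∀ p, D.r p.1 = D.r p.2 → F p = G p) :
    ∫⁻ p, F p ∂hK.pairMeasure μ = ∫⁻ p, G p ∂hK.pairMeasure μ := by
  rw [hK.lintegral_pairMeasure' hF, hK.lintegral_pairMeasure' hG]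
  refine lintegral_congr fun x => lintegral_congr_ae ?_
  filter_upwards [hK.ae_r_eq (D.r x)] with y hy
  exact h (x, y) hy.symm

lemma lintegral_pairMeasure_swap (hK : IsBorelHaarSystem D K g) {G : Arr × Arr → ℝ≥0∞}
    (hG : Measurable G) :
    ∫⁻ p, G p.swap ∂hK.pairMeasure μ = ∫⁻ p, G p ∂hK.pairMeasure μ := by
  have := hK.isSFiniteKernel
  have hGs : Measurable fun p : Arr × Arr => G p.swap := hG.comp measurable_swap
  rw [hK.lintegral_pairMeasure hG, hK.lintegral_pairMeasure hGs]
  refine lintegral_congr fun u => ?_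
  exact lintegral_lintegral_swap hGs.aemeasurable

lemma sigmaFinite_pairMeasure (hK : IsBorelHaarSystem D K g) :
    SigmaFinite (hK.pairMeasure μ) := by
  obtain ⟨q, hqm, hq0, hqt, hq⟩ := exists_measurable_lintegral_le_one μ
  have hg := hK.measurable_weight
  have hm : Measurable fun p : Arr × Arr => q (D.r p.1) * (g p.1 * g p.2) :=
    (hqm.comp (hK.measurable_r.comp measurable_fst)).mul
      ((hg.comp measurable_fst).mul (hg.comp measurable_snd))
  refine sigmaFinite_of_lintegral_ne_top hm
    (fun p => mul_ne_zero (hq0 _) (mul_ne_zero (hK.weight_ne_zero _) (hK.weight_ne_zero _)))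
    (fun p => ENNReal.mul_ne_top (hqt _)
      (ENNReal.mul_ne_top (hK.weight_ne_top _) (hK.weight_ne_top _))) ?_
  rw [hK.lintegral_pairMeasure hm]
  refine ((lintegral_mono (g := fun u => q u * (2 * 2)) fun u => ?_).trans_lt ?_).ne
  · calc ∫⁻ x, ∫⁻ y, q (D.r x) * (g x * g y) ∂K u ∂K u
        = ∫⁻ x, q u * (g x * ∫⁻ y, g y ∂K u) ∂K u := by
          refine lintegral_congr_ae ((hK.ae_r_eq u).mono fun x hx => ?_)
          simp only [hx]
          rw [lintegral_const_mul _ (hg.const_mul _), lintegral_const_mul _ hg]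
      _ = q u * ((∫⁻ x, g x ∂K u) * ∫⁻ y, g y ∂K u) := by
          rw [lintegral_const_mul _ (hg.mul_const _), lintegral_mul_const _ hg]
      _ ≤ q u * (2 * 2) := by gcongr <;> exact hK.lintegral_weight_le u
  · rw [lintegral_mul_const _ hqm]
    exact ENNReal.mul_lt_top (hq.trans_lt (by simp)) (by simp [ENNReal.mul_lt_top_iff])

/-- If `ε` is a density of the inverse of `ν = μ ∘ K` with respect to `ν`, then the shear has
Jacobian `(x, y) ↦ ε x`. -/
lemma lintegral_pairMeasure_shear (hD : D.IsGroupoid) (hK : IsBorelHaarSystem D K g)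
    {ε : Arr → ℝ≥0∞} (hε : Measurable ε)
    (hν : (μ.bind K).withDensity ε = (μ.bind K).map D.inv) {G : Arr × Arr → ℝ≥0∞}
    (hG : Measurable G) :
    ∫⁻ p, ε p.1 * G (D.shear p) ∂hK.pairMeasure μ = ∫⁻ p, G p ∂hK.pairMeasure μ := by
  have := hK.isSFiniteKernel
  let H : Arr → ℝ≥0∞ := fun x => ∫⁻ b, G (x, D.comp x b) ∂K (D.s x)
  have hpair : Measurable fun p : Arr × Arr => (p.1, D.comp p.1 p.2) :=
    measurable_fst.prodMk hK.measurable_comp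
  have hH : Measurable H :=
    Measurable.lintegral_kernel_prod_right (κ := K.comap D.s hK.measurable_s)
      (f := fun x b => G (x, D.comp x b)) (hG.comp hpair)
  have hHinv : Measurable fun x => H (D.inv x) := hH.comp hK.measurable_inv
  have hGs : Measurable fun p => G (D.shear p) := hG.comp hK.measurable_shear
  have hεGs : Measurable fun p : Arr × Arr => ε p.1 * G (D.shear p) :=
    (hε.comp measurable_fst).mul hGs
  rw [hK.lintegral_pairMeasure' hG, hK.lintegral_pairMeasure' hεGs]
  calc ∫⁻ x, ∫⁻ y, ε x * G (D.shear (x, y)) ∂K (D.r x) ∂(μ.bind K)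
      = ∫⁻ x, ε x * H (D.inv x) ∂(μ.bind K) := by
        refine lintegral_congr fun x => ?_
        have hGx : Measurable fun y => G (D.shear (x, y)) := hGs.comp measurable_prodMk_left
        rw [lintegral_const_mul _ hGx]
        simp only [H, GroupoidData.shear, hD.s_inv]
    _ = ∫⁻ x, H (D.inv x) ∂((μ.bind K).map D.inv) := by
        rw [← hν, lintegral_withDensity_eq_lintegral_mul _ hε hHinv]
        rfl
    _ = ∫⁻ x, H x ∂(μ.bind K) := by
        rw [lintegral_map hHinv hK.measurable_inv]
        simp only [hD.inv_inv]
    _ = ∫⁻ x, ∫⁻ y, G (x, y) ∂K (D.r x) ∂(μ.bind K) :=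
        lintegral_congr fun x =>
          hK.lintegral_comp x (f := fun y => G (x, y)) (hG.comp measurable_prodMk_left)

/-- A density of the inverse of `ν = μ ∘ K` with respect to `ν` is almost everywhere
multiplicative. -/
lemma ae_density_comp (hD : D.IsGroupoid) (hK : IsBorelHaarSystem D K g)
    {ε : Arr → ℝ≥0∞} (hε : Measurable ε)
    (hν : (μ.bind K).withDensity ε = (μ.bind K).map D.inv) :
    ∀ᵐ x ∂(μ.bind K), ∀ᵐ b ∂K (D.s x), ε (D.comp x b) = ε x * ε b := by
  have := hK.isSFiniteKernel
  have := hK.sigmaFinite_bind μ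
  have := hK.sigmaFinite_pairMeasure (μ := μ)
  have hT := hK.measurable_shear
  have h1 : Measurable fun p : Arr × Arr => ε p.1 := hε.comp measurable_fst
  have h2 : Measurable fun p : Arr × Arr => ε p.2 := hε.comp measurable_snd
  have h12 : Measurable fun p : Arr × Arr => ε p.1 * ε (D.shear p).2 := h1.mul (h2.comp hT)
  have key : (fun p : Arr × Arr => ε p.2) =ᵐ[hK.pairMeasure μ]
      fun p => ε p.1 * ε (D.shear p).2 := by
    refine ae_eq_of_forall_setLIntegral_eq_of_sigmaFinite h2 h12 fun A hA _ => ?_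
    let W : Arr × Arr → Arr × Arr := fun p => (D.shear p.swap).swap
    have hW : Measurable W := measurable_swap.comp (hT.comp measurable_swap)
    let J : Arr × Arr → ℝ≥0∞ := A.indicator 1
    have hJ : Measurable J := measurable_one.indicator hA
    have hJW : Measurable fun p => J (W p) := hJ.comp hW
    have hset (f : Arr × Arr → ℝ≥0∞) : ∫⁻ p in A, f p ∂hK.pairMeasure μ =
        ∫⁻ p, f p * J p ∂hK.pairMeasure μ := by
      rw [← lintegral_indicator hA]
      refine lintegral_congr fun p => ?_
      by_cases hp : p ∈ A <;> simp [J, hp]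
    have hWW {p : Arr × Arr} (hp : D.r p.1 = D.r p.2) : W (W p) = p := by
      simp only [W, Prod.swap_swap, hD.shear_shear (p := p.swap) hp.symm]
    rw [hset, hset]
    calc ∫⁻ p, ε p.2 * J p ∂hK.pairMeasure μ
        = ∫⁻ p, ε p.2 * J (W (D.shear p.swap).swap) ∂hK.pairMeasure μ :=
          hK.lintegral_pairMeasure_congr (h2.mul hJ) (h2.mul (hJW.comp hW)) fun p hp => by
            rw [show (D.shear p.swap).swap = W p from rfl, hWW hp]
      _ = ∫⁻ p, ε p.1 * J (W (D.shear p).swap) ∂hK.pairMeasure μ :=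
          hK.lintegral_pairMeasure_swap
            (h1.mul (hJW.comp (measurable_swap.comp hT)))
      _ = ∫⁻ p, J (W p.swap) ∂hK.pairMeasure μ :=
          hK.lintegral_pairMeasure_shear hD hε hν (hJW.comp measurable_swap)
      _ = ∫⁻ p, J (W p) ∂hK.pairMeasure μ := hK.lintegral_pairMeasure_swap hJW
      _ = ∫⁻ p, ε p.1 * J (W (D.shear p)) ∂hK.pairMeasure μ :=
          (hK.lintegral_pairMeasure_shear hD hε hν hJW).symm
      _ = ∫⁻ p, ε p.2 * J (W (D.shear p.swap)) ∂hK.pairMeasure μ :=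
          (hK.lintegral_pairMeasure_swap (h1.mul (hJW.comp hT))).symm
      _ = ∫⁻ p, ε p.1 * (ε (D.shear p).2 * J (W (D.shear (D.shear p).swap)))
            ∂hK.pairMeasure μ :=
          (hK.lintegral_pairMeasure_shear hD hε hν
            (h2.mul (hJW.comp (hT.comp measurable_swap)))).symm
      _ = ∫⁻ p, ε p.1 * ε (D.shear p).2 * J p ∂hK.pairMeasure μ :=
          hK.lintegral_pairMeasure_congr
            (h1.mul ((h2.comp hT).mul (hJW.comp (hT.comp (measurable_swap.comp hT)))))
            (h12.mul hJ) fun p hp => by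
              rw [hD.shear_swap_shear hp, show (D.shear p.swap).swap = W p from rfl, hWW hp,
                mul_assoc]
  filter_upwards [Measure.ae_ae_of_ae_compProd key] with x hx
  filter_upwards [hK.ae_comp x hx, hK.ae_r_eq (D.s x)] with b hb hrb
  simpa only [GroupoidData.shear, hD.inv_comp_cancel hrb.symm] using hb

end IsBorelHaarSystem

namespace IsBorelHaarSystem

variable {Arr Obj : Type} [MeasurableSpace Arr] [MeasurableSpace Obj]
  {D : GroupoidData Arr Obj} {K : Kernel Obj Arr} {g : Arr → ℝ≥0∞}

/-- Left translation by the arrow `x` almost everywhere multiplies `ε` by the constant `c`. -/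
def ScalesBy (D : GroupoidData Arr Obj) (K : Kernel Obj Arr) (ε : Arr → ℝ≥0∞) (x : Arr)
    (c : ℝ≥0∞) : Prop :=
  c ≠ 0 ∧ c ≠ ⊤ ∧ ∀ᵐ b ∂K (D.s x), ε (D.comp x b) = c * ε b

variable {ε : Arr → ℝ≥0∞}

lemma ScalesBy.comp (hD : D.IsGroupoid) (hK : IsBorelHaarSystem D K g) {x y : Arr}
    (hxy : D.s x = D.r y) {c d : ℝ≥0∞} (hx : ScalesBy D K ε x c) (hy : ScalesBy D K ε y d) :
    ScalesBy D K ε (D.comp x y) (c * d) := by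
  obtain ⟨hc0, hct, hx⟩ := hx
  obtain ⟨hd0, hdt, hy⟩ := hy
  refine ⟨mul_ne_zero hc0 hd0, ENNReal.mul_ne_top hct hdt, ?_⟩
  rw [hxy] at hx
  rw [hD.s_comp _ _ hxy]
  filter_upwards [hK.ae_comp y hx, hy, hK.ae_r_eq (D.s y)] with b hxb hyb hb
  rw [hD.comp_assoc _ _ _ hxy hb.symm, hxb, hyb, mul_assoc]

lemma ScalesBy.inv (hD : D.IsGroupoid) (hK : IsBorelHaarSystem D K g) {x : Arr} {c : ℝ≥0∞}
    (hx : ScalesBy D K ε x c) : ScalesBy D K ε (D.inv x) c⁻¹ := by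
  obtain ⟨hc0, hct, hx⟩ := hx
  refine ⟨ENNReal.inv_ne_zero.2 hct, ENNReal.inv_ne_top.2 hc0, ?_⟩
  rw [← hD.r_inv x] at hx
  filter_upwards [hK.ae_comp (D.inv x) hx, hK.ae_r_eq (D.s (D.inv x))] with b hb hrb
  rw [hD.comp_inv_cancel ((hD.s_inv x).symm.trans hrb.symm)] at hb
  rw [hb, ← mul_assoc, ENNReal.inv_mul_cancel hc0 hct, one_mul]

/-- If almost all arrows into `r x` and into `s x` scale `ε`, then so does `x`. -/
lemma exists_scalesBy (hD : D.IsGroupoid) (hK : IsBorelHaarSystem D K g) {x : Arr}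
    (hr : ∀ᵐ a ∂K (D.r x), ∃ c, ScalesBy D K ε a c)
    (hs : ∀ᵐ a ∂K (D.s x), ∃ c, ScalesBy D K ε a c) : ∃ c, ScalesBy D K ε x c := by
  have : NeZero (K (D.s x)) := ⟨hK.ne_zero _⟩
  obtain ⟨b, ⟨c, hc⟩, ⟨d, hd⟩, hb⟩ :=
    ((hK.ae_comp x hr).and (hs.and (hK.ae_r_eq (D.s x)))).exists
  have h := ScalesBy.comp hD hK (by rw [hD.s_comp _ _ hb.symm, hD.r_inv]) hc (hd.inv hD hK)
  rw [hD.comp_comp_inv_cancel hb.symm] at h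
  exact ⟨_, h⟩

/-- The average over `b` of `ε b / ε (x b)`. -/
noncomputable def averagedRatio (D : GroupoidData Arr Obj) (K : Kernel Obj Arr)
    (g ε : Arr → ℝ≥0∞) (x : Arr) : ℝ≥0∞ :=
  (∫⁻ b, ε b * (ε (D.comp x b))⁻¹ * g b ∂K (D.s x)) / ∫⁻ b, g b ∂K (D.s x)

lemma measurable_averagedRatio (hK : IsBorelHaarSystem D K g) (hε : Measurable ε) :
    Measurable (averagedRatio D K g ε) := by
  have := hK.isSFiniteKernel
  have hg := hK.measurable_weight
  have hlint : Measurable fun p : Arr × Arr => ε p.2 * (ε (D.comp p.1 p.2))⁻¹ * g p.2 :=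
    ((hε.comp measurable_snd).mul (hε.comp hK.measurable_comp).inv).mul (hg.comp measurable_snd)
  exact (Measurable.lintegral_kernel_prod_right (κ := K.comap D.s hK.measurable_s)
    (f := fun x b => ε b * (ε (D.comp x b))⁻¹ * g b) hlint).div
    ((Measure.measurable_lintegral hg).comp (K.measurable.comp hK.measurable_s))

lemma ScalesBy.averagedRatio_eq (hK : IsBorelHaarSystem D K g) (hε0 : ∀ a, ε a ≠ 0)
    (hεt : ∀ a, ε a ≠ ⊤) {x : Arr} {c : ℝ≥0∞} (hx : ScalesBy D K ε x c) :
    averagedRatio D K g ε x = c⁻¹ := by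
  obtain ⟨hc0, hct, hx⟩ := hx
  have hg0 : ∫⁻ b, g b ∂K (D.s x) ≠ 0 := by
    rw [Ne, lintegral_eq_zero_iff hK.measurable_weight]
    intro h
    have : NeZero (K (D.s x)) := ⟨hK.ne_zero _⟩
    obtain ⟨b, hb⟩ := h.exists
    exact hK.weight_ne_zero b hb
  have hgt : ∫⁻ b, g b ∂K (D.s x) ≠ ⊤ := ((hK.lintegral_weight_le _).trans_lt (by simp)).ne
  have hcongr : ∀ᵐ b ∂K (D.s x), ε b * (ε (D.comp x b))⁻¹ * g b = c⁻¹ * g b := by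
    filter_upwards [hx] with b hb
    rw [hb, ENNReal.mul_inv (.inl hc0) (.inl hct), mul_left_comm,
      ENNReal.mul_inv_cancel (hε0 b) (hεt b), mul_one]
  rw [averagedRatio, lintegral_congr_ae hcongr, lintegral_const_mul _ hK.measurable_weight,
    ENNReal.mul_div_cancel_right hg0 hgt]

/-- The modular function of a quasi-invariant measure can be chosen to be Borel and multiplicative
on the restriction of the groupoid to a conull set of units. -/
theorem exists_multiplicative_density (hD : D.IsGroupoid) (hK : IsBorelHaarSystem D K g)
    {μ : Measure Obj} [SigmaFinite μ] (hqi : IsQuasiInvariant K D.inv μ) :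
    ∃ Δ : Arr → ℝ≥0∞, Measurable Δ ∧
      ((nuMeasure K μ).map D.inv).withDensity Δ = nuMeasure K μ ∧
      ∃ V : Set Obj, μ Vᶜ = 0 ∧
        ∀ a b, D.s a = D.r b → D.r a ∈ V → D.s a ∈ V → D.s b ∈ V →
          Δ (D.comp a b) = Δ a * Δ b := by
  obtain ⟨hac, hac'⟩ := hqi
  simp only [nuMeasure] at hac hac' ⊢
  set ν := μ.bind K with hν_def
  have : SigmaFinite ν := hK.sigmaFinite_bind μ
  let invEquiv : Arr ≃ᵐ Arr :=
    { toEquiv := Function.Involutive.toPerm D.inv hD.inv_inv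
      measurable_toFun := hK.measurable_inv
      measurable_invFun := hK.measurable_inv }
  have : SigmaFinite (ν.map D.inv) := invEquiv.sigmaFinite_map
  let ρ := (ν.map D.inv).rnDeriv ν
  have hρ : Measurable ρ := Measure.measurable_rnDeriv _ _
  let bad : Set Arr := {a | ρ a = 0 ∨ ρ a = ⊤}
  have hbad : MeasurableSet bad :=
    (hρ (measurableSet_singleton 0)).union (hρ (measurableSet_singleton ⊤))
  classical
  let ε : Arr → ℝ≥0∞ := bad.piecewise 1 ρ
  have hε : Measurable ε := measurable_one.piecewise hbad hρ
  have hε_ne (a) : ε a ≠ 0 ∧ ε a ≠ ⊤ := by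
    by_cases ha : a ∈ bad
    · simp [ε, ha]
    · simpa [ε, Set.piecewise_eq_of_notMem _ _ _ ha, bad] using ha
  have hερ : ε =ᵐ[ν] ρ := by
    filter_upwards [Measure.rnDeriv_pos' hac, Measure.rnDeriv_ne_top (ν.map D.inv) ν] with a h0 ht
    have ha : a ∉ bad := fun h => h.elim h0.ne' ht
    simp [ε, ha]
  have hεν : ν.withDensity ε = ν.map D.inv := by
    rw [withDensity_congr_ae hερ, Measure.withDensity_rnDeriv_eq _ _ hac']
  have hscale : ∀ᵐ x ∂ν, ScalesBy D K ε x (ε x) :=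
    (hK.ae_density_comp hD hε hεν).mono fun x hx => ⟨(hε_ne x).1, (hε_ne x).2, hx⟩
  have hΔ := hK.measurable_averagedRatio hε
  have hΔeq {x : Arr} {c : ℝ≥0∞} (hx : ScalesBy D K ε x c) :
      averagedRatio D K g ε x = c⁻¹ :=
    hx.averagedRatio_eq hK (fun a => (hε_ne a).1) fun a => (hε_ne a).2
  refine ⟨averagedRatio D K g ε, hΔ, ?_, {u | ∀ᵐ a ∂K u, ∃ c, ScalesBy D K ε a c}, ?_, ?_⟩
  · rw [← hεν, ← withDensity_mul _ hε hΔ]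
    conv_rhs => rw [← withDensity_one (μ := ν)]
    refine withDensity_congr_ae ?_
    filter_upwards [hscale] with x hx
    rw [Pi.mul_apply, hΔeq hx, ENNReal.mul_inv_cancel (hε_ne x).1 (hε_ne x).2, Pi.one_apply]
  · exact Measure.ae_ae_of_ae_bind K.aemeasurable (hscale.mono fun x hx => ⟨_, hx⟩)
  · intro a b hab hra hsa hsb
    obtain ⟨c, hc⟩ := exists_scalesBy hD hK hra hsa
    obtain ⟨d, hd⟩ := exists_scalesBy hD hK (x := b) (by rwa [hab] at hsa) hsb
    rw [hΔeq hc, hΔeq hd, hΔeq (hc.comp hD hK hab hd), ENNReal.mul_inv (.inl hc.1) (.inl hc.2.1)]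

end IsBorelHaarSystem

/-- The groupoid data with the composition redefined on the pairs that are not composable. -/
noncomputable def GroupoidData.trimComp {Arr Obj : Type} (D : GroupoidData Arr Obj) :
    GroupoidData Arr Obj :=
  { D with comp := fun a b => open Classical in if D.s a = D.r b then D.comp a b else a }

namespace GroupoidData

variable {Arr Obj : Type} {D : GroupoidData Arr Obj}

lemma trimComp_comp {a b : Arr} (h : D.s a = D.r b) : D.trimComp.comp a b = D.comp a b :=
  if_pos h

lemma IsGroupoid.trimComp (hD : D.IsGroupoid) : D.trimComp.IsGroupoid where
  r_unit := hD.r_unit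
  s_unit := hD.s_unit
  r_comp a b h := by rw [trimComp_comp (D := D) h]; exact hD.r_comp a b h
  s_comp a b h := by rw [trimComp_comp (D := D) h]; exact hD.s_comp a b h
  comp_assoc a b c hab hbc := by
    rw [trimComp_comp (D := D) hab, trimComp_comp (D := D) hbc,
      trimComp_comp (D := D) ((hD.s_comp a b hab).trans hbc),
      trimComp_comp (D := D) (hab.trans (hD.r_comp b c hbc).symm)]
    exact hD.comp_assoc a b c hab hbc
  unit_comp a := (trimComp_comp (hD.s_unit _)).trans (hD.unit_comp a)
  comp_unit a := (trimComp_comp (hD.r_unit _).symm).trans (hD.comp_unit a)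
  r_inv := hD.r_inv
  s_inv := hD.s_inv
  inv_comp a := (trimComp_comp (hD.s_inv a)).trans (hD.inv_comp a)
  comp_inv a := (trimComp_comp (hD.r_inv a).symm).trans (hD.comp_inv a)

variable [TopologicalSpace Arr] [TopologicalSpace Obj]

lemma continuousOn_uncurry_comp (hDtop : IsTopologicalGroupoid D) :
    ContinuousOn (Function.uncurry D.comp) {p | D.s p.1 = D.r p.2} :=
  continuousOn_iff_continuous_domRestrict.2 hDtop.continuous_comp

lemma continuousOn_comp (hDtop : IsTopologicalGroupoid D) (a : Arr) :
    ContinuousOn (D.comp a) {b | D.s a = D.r b} :=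
  (continuousOn_uncurry_comp hDtop).comp (by fun_prop : Continuous fun b => (a, b)).continuousOn
    fun _ hb => hb

variable [T2Space Obj] [SecondCountableTopology Arr] [MeasurableSpace Arr] [BorelSpace Arr]

lemma measurable_trimComp (hDtop : IsTopologicalGroupoid D) :
    Measurable (Function.uncurry D.trimComp.comp) := by
  classical
  have hclosed : IsClosed {p : Arr × Arr | D.s p.1 = D.r p.2} :=
    isClosed_eq (hDtop.continuous_s.comp continuous_fst) (hDtop.continuous_r.comp continuous_snd)
  convert (continuousOn_uncurry_comp hDtop).measurable_piecewise continuous_fst.continuousOn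
    hclosed.measurableSet using 1
  ext p
  by_cases hp : D.s p.1 = D.r p.2 <;> simp [trimComp, Function.uncurry, hp]

end GroupoidData

/-- A Haar system is left invariant as a family of measures. -/
lemma IsHaarSystemOn.map_trimComp {Arr Obj : Type} [TopologicalSpace Arr] [TopologicalSpace Obj]
    [T2Space Arr] [T2Space Obj] [SecondCountableTopology Arr] [LocallyCompactSpace Arr]
    [MeasurableSpace Arr] [BorelSpace Arr] {D : GroupoidData Arr Obj} (hD : D.IsGroupoid)
    (hDtop : IsTopologicalGroupoid D) {κ : Obj → Measure Arr}
    (hκ : IsHaarSystemOn D Set.univ κ) (a : Arr) :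
    (κ (D.s a)).map (D.trimComp.comp a) = κ (D.r a) := by
  obtain ⟨hfib, -, hfin, hinv, -⟩ := hκ
  have hm : Measurable (D.trimComp.comp a) :=
    (GroupoidData.measurable_trimComp hDtop).comp measurable_prodMk_left
  have hfib_ae : ∀ᵐ b ∂κ (D.s a), D.r b = D.s a := by simpa [ae_iff, Set.compl_def] using hfib _
  have : IsFiniteMeasureOnCompacts (κ (D.r a)) := ⟨fun K hK => hfin _ K hK⟩
  have : IsFiniteMeasureOnCompacts ((κ (D.s a)).map (D.trimComp.comp a)) := ⟨fun L hL => by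
    have hclosed : IsClosed {b | D.s (D.inv a) = D.r b} :=
      isClosed_eq continuous_const hDtop.continuous_r
    have hcompact : IsCompact (D.comp (D.inv a) '' (L ∩ {b | D.s (D.inv a) = D.r b})) :=
      (hL.inter_right hclosed).image_of_continuousOn
        ((GroupoidData.continuousOn_comp hDtop _).mono Set.inter_subset_right)
    rw [Measure.map_apply hm hL.measurableSet]
    refine (measure_mono_ae ?_).trans_lt (hfin (D.s a) _ hcompact)
    filter_upwards [hfib_ae] with b hb hbL
    have hbL' : D.comp a b ∈ L := by
      rw [← GroupoidData.trimComp_comp hb.symm]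
      exact hbL
    exact ⟨D.comp a b, ⟨hbL', (hD.s_inv a).trans (hD.r_comp a b hb.symm).symm⟩,
      hD.inv_comp_cancel hb.symm⟩⟩
  refine Measure.ext_of_integral_eq_on_compactlySupported fun f => ?_
  have hf : Continuous f := f.continuous
  rw [integral_map hm.aemeasurable hf.aestronglyMeasurable,
    ← hinv a trivial f hf f.hasCompactSupport]
  refine integral_congr_ae ?_
  filter_upwards [hfib_ae] with b hb
  rw [GroupoidData.trimComp_comp hb.symm]

/-- For a second countable locally compact Hausdorff groupoid
`S` with Haar system `κ` and a quasi-invariant Radon measure `μ` on the unit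
space, the modular function (the Radon–Nikodym derivative of `ν = μ∘κ` with
respect to its image under inversion) can be chosen to be a Borel function
which is multiplicative on the restriction `S|_V` for some `μ`-conull `V`. -/
theorem statement4 {Arr Obj : Type} [TopologicalSpace Arr] [TopologicalSpace Obj]
    [T2Space Arr] [T2Space Obj] [SecondCountableTopology Arr]
    [SecondCountableTopology Obj] [LocallyCompactSpace Arr] [LocallyCompactSpace Obj]
    [MeasurableSpace Arr] [MeasurableSpace Obj] [BorelSpace Arr] [BorelSpace Obj]
    (D : GroupoidData Arr Obj) (hD : D.IsGroupoid) (hDtop : IsTopologicalGroupoid D)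
    (κ : Obj → MeasureTheory.Measure Arr) (hκ : IsHaarSystemOn D Set.univ κ)
    (μ : MeasureTheory.Measure Obj) [μ.Regular]
    (hqi : IsQuasiInvariant κ D.inv μ) :
    ∃ Δ : Arr → ℝ≥0∞, Measurable Δ ∧
      ((nuMeasure κ μ).map D.inv).withDensity Δ = nuMeasure κ μ ∧
      ∃ V : Set Obj, μ Vᶜ = 0 ∧
        ∀ a b, D.s a = D.r b → D.r a ∈ V → D.s a ∈ V → D.s b ∈ V →
          Δ (D.comp a b) = Δ a * Δ b := by
  obtain ⟨hfib, hsupp, hfin, -, hcont⟩ := id hκ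
  have hfib_ae (u) : ∀ᵐ a ∂κ u, D.r a = u := by simpa [ae_iff, Set.compl_def] using hfib u
  have hmeas : Measurable κ := measurable_of_continuous_integral hfin hcont
  obtain ⟨g, hg, hg0, hgt, hgint⟩ :=
    exists_weight hmeas hDtop.continuous_r.measurable hfib_ae hfin
  have hK : IsBorelHaarSystem D.trimComp ⟨κ, hmeas⟩ g :=
    { measurable_r := hDtop.continuous_r.measurable
      measurable_s := hDtop.continuous_s.measurable
      measurable_inv := hDtop.continuous_inv.measurable
      measurable_comp := GroupoidData.measurable_trimComp hDtop
      ae_r_eq := hfib_ae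
      ne_zero := fun u hu => by
        have h := hsupp u Set.univ isOpen_univ ⟨D.unit u, by simp [hD.r_unit]⟩
        rw [show κ u = 0 from hu] at h
        simp at h
      map_comp := hκ.map_trimComp hD hDtop
      measurable_weight := hg
      weight_ne_zero := hg0
      weight_ne_top := hgt
      lintegral_weight_le := hgint }
  obtain ⟨Δ, hΔ, hdens, V, hV, hmul⟩ := hK.exists_multiplicative_density hD.trimComp hqi
  refine ⟨Δ, hΔ, hdens, V, hV, fun a b hab hra hsa hsb => ?_⟩
  rw [← GroupoidData.trimComp_comp hab]
  exact hmul a b hab hra hsa hsb
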